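/- Potential-theoretic converse: Let E ⊂ ℝ^d with ν̃^s(E) = +∞. Then for every 0 < ε < s there exists a Radon measure μ^ε on ℝ^d with μ^ε(E) = +∞ and Σ_{n≥0} 2^{n(s−ε)} I_{s−ε}(μ^ε|_{S_n}) < +∞. -/

import Mathlib

open Metric Set ENNReal MeasureTheory

noncomputable def shell (X : Type*) [NormedAddCommGroup X] (n : ℕ) : Set X :=
  if n = 0 then Metric.ball 0 1 else Metric.ball 0 ((2:ℝ)^n) \ Metric.ball 0 ((2:ℝ)^(n-1))

noncomputable def nuT {X : Type*} [NormedAddCommGroup X] (s : ℝ) (n : ℕ) (E : Set X) : ℝ≥0∞ :=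
  sInf { t : ℝ≥0∞ | ∃ (m : ℕ) (x : Fin m → X) (r : Fin m → ℝ),
    (∀ i, x i ∈ shell X n) ∧ (∀ i, 1 ≤ r i) ∧
    (E ∩ shell X n ⊆ ⋃ i, Metric.ball (x i) (r i)) ∧
    t = ∑ i, ENNReal.ofReal ((r i / 2^n)^s) }

noncomputable def macroDim {X : Type*} [NormedAddCommGroup X] (E : Set X) : ℝ :=
  sInf { s : ℝ | 0 ≤ s ∧ ∑' n, nuT s n E < ⊤ }

def IsIntegerPoint {d : ℕ} (x : EuclideanSpace ℝ (Fin d)) : Prop := ∀ j, ∃ z : ℤ, x j = (z : ℝ)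

def IsProperCover {d : ℕ} (n : ℕ) (E : Set (EuclideanSpace ℝ (Fin d))) {m : ℕ}
    (x : Fin m → EuclideanSpace ℝ (Fin d)) (r : Fin m → ℕ) : Prop :=
  (∀ i, x i ∈ shell (EuclideanSpace ℝ (Fin d)) n) ∧ (∀ i, IsIntegerPoint (x i)) ∧
  (∀ i, 1 ≤ r i) ∧ (E ∩ shell (EuclideanSpace ℝ (Fin d)) n ⊆ ⋃ i, Metric.ball (x i) ((r i : ℝ)))

noncomputable def nuP {d : ℕ} (s : ℝ) (n : ℕ) (E : Set (EuclideanSpace ℝ (Fin d))) : ℝ≥0∞ :=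
  sInf { t : ℝ≥0∞ | ∃ (m : ℕ) (x : Fin m → EuclideanSpace ℝ (Fin d)) (r : Fin m → ℕ),
    IsProperCover n E x r ∧ t = ∑ i, ENNReal.ofReal (((r i : ℝ) / 2^n)^s) }

/-- The macroscopic `s`-energy of a measure `ν`. -/
noncomputable def energy {X : Type*} [NormedAddCommGroup X] [MeasurableSpace X]
    (s : ℝ) (ν : Measure X) : ℝ≥0∞ :=
  ∫⁻ x, ∫⁻ y, ENNReal.ofReal (1 / max (‖x - y‖ ^ s) 1) ∂ν ∂ν

open Filter Topology

/-- A maximal packing: weights that respect every constraint and leave each index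
in at least one saturated constraint. -/
theorem exists_saturated_weights {ι κ : Type*} [Fintype ι] [Finite κ] (B : κ → Finset ι)
    (c : κ → ℝ) (hc : ∀ k, 0 ≤ c k) (hB : ∀ i, ∃ k, i ∈ B k) :
    ∃ w : ι → ℝ, (∀ i, 0 ≤ w i) ∧ (∀ k, ∑ i ∈ B k, w i ≤ c k) ∧
      ∀ i, ∃ k, i ∈ B k ∧ ∑ j ∈ B k, w j = c k := by
  classical
  set K : Set (ι → ℝ) := {w | (∀ i, 0 ≤ w i) ∧ ∀ k, ∑ i ∈ B k, w i ≤ c k} with hK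
  have hclosed : IsClosed K := by
    have : K = Set.Ici 0 ∩ ⋂ k, {w | ∑ i ∈ B k, w i ≤ c k} := by
      ext w
      simp [hK, Pi.le_def]
    rw [this]
    exact isClosed_Ici.inter
      (isClosed_iInter fun k => isClosed_le (by fun_prop) continuous_const)
  choose g hg using hB
  have hsub : K ⊆ Set.Icc (0 : ι → ℝ) (fun i => c (g i)) := fun w hw =>
    ⟨hw.1, fun i => (Finset.single_le_sum (f := w) (fun j _ => hw.1 j) (hg i)).trans (hw.2 (g i))⟩
  have hcomp : IsCompact K := isCompact_Icc.of_isClosed_subset hclosed hsub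
  have hne : K.Nonempty := ⟨0, fun i => le_rfl, fun k => by simpa using hc k⟩
  obtain ⟨w, hwK, hmax⟩ := hcomp.exists_isMaxOn hne (f := fun w => ∑ i, w i) (by fun_prop)
  refine ⟨w, hwK.1, hwK.2, fun i => ?_⟩
  by_contra! hcon
  have hev : ∀ᶠ δ in 𝓝[>] (0 : ℝ), ∀ k, i ∈ B k → ∑ j ∈ B k, w j + δ ≤ c k := by
    refine eventually_all.2 fun k => ?_
    by_cases hik : i ∈ B k
    · have hlt : ∑ j ∈ B k, w j < c k := lt_of_le_of_ne (hwK.2 k) (hcon k hik)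
      have : Set.Ioo (0 : ℝ) (c k - ∑ j ∈ B k, w j) ∈ 𝓝[>] (0 : ℝ) :=
        Ioo_mem_nhdsGT (by linarith)
      filter_upwards [this] with δ hδ _
      linarith [hδ.2]
    · exact Eventually.of_forall fun _ h => absurd h hik
  obtain ⟨δ, hδ, hδ0⟩ := (hev.and self_mem_nhdsWithin).exists
  have hδ0 : 0 < δ := hδ0
  have hmem : w + Pi.single i δ ∈ K := by
    refine ⟨fun j => ?_, fun k => ?_⟩
    · have : (0 : ℝ) ≤ (Pi.single i δ : ι → ℝ) j := by
        by_cases h : j = i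
        · subst h; simpa using hδ0.le
        · simp [h]
      simpa using add_nonneg (hwK.1 j) this
    · simp only [Pi.add_apply, Finset.sum_add_distrib, Finset.sum_pi_single']
      split_ifs with hik
      · exact hδ k hik
      · simpa using hwK.2 k
  have := hmax hmem
  simp only [Pi.add_apply, Finset.sum_add_distrib, Finset.sum_pi_single', Set.mem_ofPred_eq,
    Finset.mem_univ, if_true] at this
  linarith

/-- A discrete Frostman lemma: weights dominated by the gauge `c` on all balls of radius `2 ^ k`,
`k < N`, whose total mass is at least the cost of some family of balls covering after dilation. -/
theorem exists_discrete_frostman {X ι : Type*} [PseudoMetricSpace X] [Fintype ι] (x : ι → X)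
    (N : ℕ) [NeZero N] (c : ℕ → ℝ) (hc : ∀ k, 0 ≤ c k) :
    ∃ w : ι → ℝ, (∀ i, 0 ≤ w i) ∧
      (∀ q, ∀ k < N, ∑ p, (if dist (x p) (x q) ≤ 2 ^ k then w p else 0) ≤ c k) ∧
      ∃ u : Finset (ι × Fin N), (∀ p, ∃ b ∈ u, dist (x p) (x b.1) ≤ 5 * 2 ^ (b.2 : ℕ)) ∧
        ∑ b ∈ u, c b.2 ≤ ∑ p, w p := by
  classical
  set B : ι × Fin N → Finset ι := fun b =>
    Finset.univ.filter fun p => dist (x p) (x b.1) ≤ 2 ^ (b.2 : ℕ) with hBdef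
  obtain ⟨w, hw0, hwc, hsat⟩ := exists_saturated_weights B (fun b => c b.2) (fun b => hc _)
    (fun i => ⟨(i, 0), by simp [hBdef]⟩)
  refine ⟨w, hw0, fun q k hk => ?_, ?_⟩
  · have := hwc (q, ⟨k, hk⟩)
    rwa [Finset.sum_filter] at this
  obtain ⟨u, hut, hdisj, hcov⟩ := Vitali.exists_disjoint_subfamily_covering_enlargement_closedBall
    {b : ι × Fin N | ∑ j ∈ B b, w j = c b.2} (fun b => x b.1) (fun b => (2 : ℝ) ^ (b.2 : ℕ))
    (2 ^ N) (fun b _ => pow_le_pow_right₀ (by norm_num) b.2.2.le) 5 (by norm_num)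
  have hufin : u.Finite := u.toFinite
  refine ⟨hufin.toFinset, fun p => ?_, ?_⟩
  · obtain ⟨a, hpa, ha⟩ := hsat p
    obtain ⟨b, hbu, hb⟩ := hcov a ha
    refine ⟨b, hufin.mem_toFinset.2 hbu, ?_⟩
    have : x p ∈ closedBall (x a.1) ((2 : ℝ) ^ (a.2 : ℕ)) := by
      simpa [hBdef, mem_closedBall] using hpa
    exact hb this
  · calc ∑ b ∈ hufin.toFinset, c b.2 = ∑ b ∈ hufin.toFinset, ∑ j ∈ B b, w j :=
          Finset.sum_congr rfl fun b hb => (hut (hufin.mem_toFinset.1 hb)).symm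
      _ = ∑ j ∈ hufin.toFinset.biUnion B, w j := by
          refine (Finset.sum_biUnion fun a ha b hb hab => ?_).symm
          have := hdisj (hufin.mem_toFinset.1 ha) (hufin.mem_toFinset.1 hb) hab
          refine Finset.disjoint_left.2 fun p hpa hpb => ?_
          refine Set.disjoint_left.1 this (?_ : x p ∈ _) ?_
          · simpa [hBdef, mem_closedBall] using hpa
          · simpa [hBdef, mem_closedBall] using hpb
      _ ≤ ∑ p, w p := Finset.sum_le_sum_of_subset_of_nonneg (Finset.subset_univ _)
          fun p _ _ => hw0 p

/-- Dyadic decomposition of the truncated Riesz kernel. -/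
theorem one_div_max_rpow_le_sum {t D : ℝ} (ht : 0 ≤ t) (N : ℕ) (hD : ∃ k < N, D ≤ 2 ^ k) :
    1 / max (D ^ t) 1 ≤
      ∑ k ∈ Finset.range N, if D ≤ 2 ^ k then (2 : ℝ) ^ t / ((2 : ℝ) ^ t) ^ k else 0 := by
  classical
  have hA : (1 : ℝ) ≤ 2 ^ t := Real.one_le_rpow (by norm_num) ht
  have hA0 : (0 : ℝ) < 2 ^ t := by positivity
  have hex : ∃ k, D ≤ 2 ^ k := hD.imp fun _ h => h.2
  obtain ⟨j, hjN, hj⟩ := hD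
  have hkN : Nat.find hex < N := (Nat.find_min' hex hj).trans_lt hjN
  refine le_trans ?_ (Finset.single_le_sum (f := fun k =>
    if D ≤ 2 ^ k then (2 : ℝ) ^ t / ((2 : ℝ) ^ t) ^ k else 0)
    (fun k _ => by split_ifs <;> positivity) (Finset.mem_range.2 hkN))
  simp only [Nat.find_spec hex, if_true]
  rcases hk : Nat.find hex with _ | i
  · simp only [pow_zero, div_one]
    refine le_trans ?_ hA
    rw [div_le_one (by positivity)]
    exact le_max_right _ _
  · have hlt : (2 : ℝ) ^ i < D := by
      have := Nat.find_min hex (m := i) (by omega)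
      exact not_le.1 this
    have h1 : ((2 : ℝ) ^ t) ^ i ≤ D ^ t := by
      rw [← Real.rpow_natCast, ← Real.rpow_mul (by norm_num), mul_comm,
        Real.rpow_mul (by norm_num), Real.rpow_natCast]
      exact Real.rpow_le_rpow (by positivity) hlt.le ht
    rw [pow_succ, div_mul_cancel_right₀ hA0.ne', ← one_div]
    exact one_div_le_one_div_of_le (by positivity) (h1.trans (le_max_left _ _))

/-- Abel–Dini: a divergent bounded nonnegative series stays divergent after multiplication by
suitable weights whose squares make it converge. -/
theorem exists_weights_not_summable_summable_sq {m : ℕ → ℝ} {M : ℝ} (h0 : ∀ n, 0 ≤ m n)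
    (hM : ∀ n, m n ≤ M) (hm : ¬ Summable m) :
    ∃ a : ℕ → ℝ, (∀ n, 0 ≤ a n) ∧ ¬ Summable (fun n => a n * m n) ∧
      Summable fun n => a n ^ 2 * m n := by
  have hM0 : 0 ≤ M := (h0 0).trans (hM 0)
  set S : ℕ → ℝ := fun n => 1 + ∑ k ∈ Finset.range n, m k with hS
  have hS1 : ∀ n, 1 ≤ S n := fun n => le_add_of_nonneg_right (Finset.sum_nonneg fun k _ => h0 k)
  have hSpos : ∀ n, 0 < S n := fun n => zero_lt_one.trans_le (hS1 n)
  have hSsucc : ∀ n, S (n + 1) = S n + m n := fun n => by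
    simp only [hS, Finset.sum_range_succ]; ring
  refine ⟨fun n => (S n)⁻¹, fun n => (inv_pos.2 (hSpos n)).le, ?_, ?_⟩
  · have htop : Tendsto S atTop atTop :=
      tendsto_atTop_add_const_left _ _ ((not_summable_iff_tendsto_nat_atTop_of_nonneg h0).1 hm)
    have hnn : ∀ n, 0 ≤ (S n)⁻¹ * m n := fun n => mul_nonneg (inv_pos.2 (hSpos n)).le (h0 n)
    rw [not_summable_iff_tendsto_nat_atTop_of_nonneg hnn]
    refine tendsto_atTop_mono (fun n => ?_) (Real.tendsto_log_atTop.comp htop)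
    have hstep : ∀ k, Real.log (S (k + 1)) - Real.log (S k) ≤ (S k)⁻¹ * m k := fun k => by
      rw [← Real.log_div (hSpos _).ne' (hSpos _).ne']
      refine (Real.log_le_sub_one_of_pos (div_pos (hSpos _) (hSpos _))).trans_eq ?_
      rw [hSsucc]
      field_simp [(hSpos k).ne']
      ring
    have := Finset.sum_le_sum fun k (_ : k ∈ Finset.range n) => hstep k
    rw [Finset.sum_range_sub fun k => Real.log (S k)] at this
    simpa [hS] using this
  · refine summable_of_sum_range_le (c := 1 + M) (fun n => by have := h0 n; positivity)
      (fun n => ?_)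
    have hstep : ∀ k, (S k)⁻¹ ^ 2 * m k ≤ (1 + M) * ((S k)⁻¹ - (S (k + 1))⁻¹) := fun k => by
      have hle : S (k + 1) ≤ (1 + M) * S k := by
        rw [hSsucc]; nlinarith [hM k, hS1 k]
      have e : (S k)⁻¹ - (S (k + 1))⁻¹ = m k / (S k * S (k + 1)) := by
        rw [inv_sub_inv (hSpos _).ne' (hSpos _).ne', hSsucc]; ring
      have e' : (S k)⁻¹ ^ 2 * m k = (1 + M) * (m k / (S k * ((1 + M) * S k))) := by
        have := (hSpos k).ne'
        field_simp
      rw [e, e']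
      have := hSpos k
      have := hSpos (k + 1)
      have := h0 k
      gcongr
    have hsum := Finset.sum_le_sum fun k (_ : k ∈ Finset.range n) => hstep k
    rw [← Finset.mul_sum, Finset.sum_range_sub' fun k => (S k)⁻¹] at hsum
    refine hsum.trans ?_
    have : (S 0)⁻¹ = 1 := by simp [hS]
    have h2 : 0 ≤ (S n)⁻¹ := (inv_pos.2 (hSpos n)).le
    nlinarith

theorem norm_lt_of_mem_shell {X : Type*} [NormedAddCommGroup X] {n : ℕ} {x : X}
    (hx : x ∈ shell X n) : ‖x‖ < 2 ^ n := by
  unfold shell at hx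
  split_ifs at hx with h
  · subst h; simpa using hx
  · simpa using hx.1

theorem le_norm_of_mem_shell {X : Type*} [NormedAddCommGroup X] {m n : ℕ} (hmn : m < n) {x : X}
    (hx : x ∈ shell X n) : 2 ^ m ≤ ‖x‖ := by
  unfold shell at hx
  rw [if_neg (by omega)] at hx
  have : (2 : ℝ) ^ (n - 1) ≤ ‖x‖ := by simpa using hx.2
  exact (pow_le_pow_right₀ (by norm_num) (by omega)).trans this

theorem eq_of_mem_shell {X : Type*} [NormedAddCommGroup X] {m n : ℕ} {x : X}
    (hm : x ∈ shell X m) (hn : x ∈ shell X n) : m = n := by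
  rcases lt_trichotomy m n with h | h | h
  · exact absurd (norm_lt_of_mem_shell hm) (le_norm_of_mem_shell h hn).not_gt
  · exact h
  · exact absurd (norm_lt_of_mem_shell hn) (le_norm_of_mem_shell h hm).not_gt

theorem measurableSet_shell {X : Type*} [NormedAddCommGroup X] [MeasurableSpace X] [BorelSpace X]
    (n : ℕ) : MeasurableSet (shell X n) := by
  unfold shell
  split_ifs
  · exact measurableSet_ball
  · exact measurableSet_ball.diff measurableSet_ball

theorem nuT_le_sum {X β : Type*} [NormedAddCommGroup X] (s : ℝ) (n : ℕ) (E : Set X)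
    (u : Finset β) (x : β → X) (r : β → ℝ) (hx : ∀ b ∈ u, x b ∈ shell X n)
    (hr : ∀ b ∈ u, 1 ≤ r b) (hE : E ∩ shell X n ⊆ ⋃ b ∈ u, Metric.ball (x b) (r b)) :
    nuT s n E ≤ ∑ b ∈ u, ENNReal.ofReal ((r b / 2 ^ n) ^ s) := by
  refine sInf_le ⟨u.card, fun i => x (u.equivFin.symm i), fun i => r (u.equivFin.symm i),
    fun i => hx _ (u.equivFin.symm i).2, fun i => hr _ (u.equivFin.symm i).2, ?_, ?_⟩
  · refine hE.trans (Set.iUnion₂_subset fun b hb => ?_)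
    refine Set.subset_iUnion_of_subset (u.equivFin ⟨b, hb⟩) ?_
    simp
  · rw [← Finset.sum_coe_sort u,
      ← u.equivFin.symm.sum_comp fun b : u => ENNReal.ofReal ((r b / 2 ^ n) ^ s)]

theorem sum_kernel_le {X ι : Type*} [NormedAddCommGroup X] [Fintype ι] {x : ι → X} {w : ι → ℝ}
    (hw : ∀ i, 0 ≤ w i) {s t : ℝ} (ht : 0 ≤ t) (hts : t < s) {n : ℕ} {q : ι}
    (hx : ∀ i, ‖x i - x q‖ ≤ 2 ^ (n + 1))
    (hc : ∀ k < n + 2, ∑ p, (if dist (x p) (x q) ≤ 2 ^ k then w p else 0) ≤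
      ((2 : ℝ) ^ k / 2 ^ n) ^ s) :
    ((2 : ℝ) ^ t) ^ n * ∑ p, w p * (1 / max (‖x q - x p‖ ^ t) 1) ≤
      2 ^ t * (2 ^ (s - t)) ^ 2 / (2 ^ (s - t) - 1) := by
  set A : ℝ := 2 ^ t with hA
  set P : ℝ := 2 ^ s with hP
  set G : ℝ := 2 ^ (s - t) with hG
  have hA0 : 0 < A := by positivity
  have hP0 : 0 < P := by positivity
  have hG1 : 1 < G := Real.one_lt_rpow (by norm_num) (by linarith)
  have hGPA : G = P / A := by rw [hG, Real.rpow_sub (by norm_num)]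
  have hPAG : P = A * G := by rw [hGPA]; field_simp
  have hpow : ∀ k : ℕ, ((2 : ℝ) ^ k) ^ s = P ^ k := fun k => by
    rw [hP, ← Real.rpow_natCast, ← Real.rpow_mul (by norm_num), mul_comm,
      Real.rpow_mul (by norm_num), Real.rpow_natCast]
  have hsum : ∑ p, w p * (1 / max (‖x q - x p‖ ^ t) 1) ≤
      ∑ k ∈ Finset.range (n + 2), A / A ^ k * (P ^ k / P ^ n) :=
    calc ∑ p, w p * (1 / max (‖x q - x p‖ ^ t) 1)
        ≤ ∑ p, ∑ k ∈ Finset.range (n + 2),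
            A / A ^ k * (if dist (x p) (x q) ≤ 2 ^ k then w p else 0) := by
          refine Finset.sum_le_sum fun p _ => ?_
          have hle := one_div_max_rpow_le_sum (D := ‖x p - x q‖) ht (n + 2)
            ⟨n + 1, by omega, hx p⟩
          rw [norm_sub_rev]
          refine (mul_le_mul_of_nonneg_left hle (hw p)).trans_eq ?_
          rw [Finset.mul_sum]
          refine Finset.sum_congr rfl fun k _ => ?_
          rw [dist_eq_norm]
          split_ifs <;> ring
      _ = ∑ k ∈ Finset.range (n + 2),
            A / A ^ k * ∑ p, (if dist (x p) (x q) ≤ 2 ^ k then w p else 0) := by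
          rw [Finset.sum_comm]
          simp only [Finset.mul_sum]
      _ ≤ _ := by
          refine Finset.sum_le_sum fun k hk => ?_
          refine mul_le_mul_of_nonneg_left ?_ (by positivity)
          rw [← hpow, ← hpow, ← Real.div_rpow (by positivity) (by positivity)]
          exact hc k (Finset.mem_range.1 hk)
  have hgeom : A ^ n * ∑ k ∈ Finset.range (n + 2), A / A ^ k * (P ^ k / P ^ n) =
      A / G ^ n * ∑ k ∈ Finset.range (n + 2), G ^ k := by
    rw [Finset.mul_sum, Finset.mul_sum]
    refine Finset.sum_congr rfl fun k _ => ?_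
    have : G ≠ 0 := by positivity
    rw [hPAG, mul_pow, mul_pow]
    field_simp
  refine (mul_le_mul_of_nonneg_left hsum (by positivity)).trans ?_
  rw [hgeom, geom_sum_eq hG1.ne']
  have hG0 : 0 < G := by positivity
  have hG1' : 0 < G - 1 := by linarith
  have : A * G ^ 2 / (G - 1) = A / G ^ n * (G ^ (n + 2) / (G - 1)) := by
    rw [pow_add]; field_simp
  rw [this]
  gcongr
  linarith

/-- Discrete Frostman measures in the shells, with linear control of their `t`-energies. -/
theorem exists_frostman_shell {X : Type*} [NormedAddCommGroup X] [ProperSpace X] (E : Set X)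
    {s t : ℝ} (ht : 0 ≤ t) (hts : t < s) (n : ℕ) :
    ∃ (m : ℕ) (x : Fin m → X) (w : Fin m → ℝ), (∀ i, x i ∈ E ∩ shell X n) ∧ (∀ i, 0 ≤ w i) ∧
      nuT s n E ≤ ENNReal.ofReal (7 ^ s * ∑ i, w i) ∧ ∑ i, w i ≤ 2 ^ s ∧
      ((2 : ℝ) ^ t) ^ n * ∑ i, ∑ j, w i * (w j * (1 / max (‖x i - x j‖ ^ t) 1)) ≤
        2 ^ t * (2 ^ (s - t)) ^ 2 / (2 ^ (s - t) - 1) * ∑ i, w i := by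
  have htb : TotallyBounded (E ∩ shell X n) :=
    (isCompact_closedBall (0 : X) (2 ^ n)).totallyBounded.subset fun y hy => by
      simpa using (norm_lt_of_mem_shell hy.2).le
  obtain ⟨F, hFE, hF, hcov⟩ := Metric.finite_approx_of_totallyBounded htb 1 one_pos
  set e := hF.toFinset.equivFin.symm
  set x : Fin hF.toFinset.card → X := fun i => e i with hxdef
  have hx : ∀ i, x i ∈ E ∩ shell X n := fun i => hFE (hF.mem_toFinset.1 (e i).2)
  have hdist : ∀ i j, ‖x i - x j‖ ≤ 2 ^ (n + 1) := fun i j => by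
    have hi := norm_lt_of_mem_shell (hx i).2
    have hj := norm_lt_of_mem_shell (hx j).2
    have := norm_sub_le (x i) (x j)
    rw [pow_succ]; linarith
  obtain ⟨w, hw0, hwc, u, hucov, hu⟩ := exists_discrete_frostman x (n + 2)
    (fun k => ((2 : ℝ) ^ k / 2 ^ n) ^ s) (fun k => by positivity)
  refine ⟨_, x, w, hx, hw0, ?_, ?_, ?_⟩
  · refine (nuT_le_sum s n E u (fun b => x b.1) (fun b => 7 * 2 ^ (b.2 : ℕ))
      (fun b _ => (hx b.1).2) (fun b _ => ?_) ?_).trans ?_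
    · have : (1 : ℝ) ≤ 2 ^ (b.2 : ℕ) := one_le_pow₀ (by norm_num)
      linarith
    · intro y hy
      obtain ⟨z, hzF, hyz⟩ := Set.mem_iUnion₂.1 (hcov hy)
      set p := e.symm ⟨z, hF.mem_toFinset.2 hzF⟩ with hp
      have hxp : x p = z := by simp [hxdef, hp]
      obtain ⟨b, hb, hpb⟩ := hucov p
      refine Set.mem_iUnion₂.2 ⟨b, hb, ?_⟩
      rw [mem_ball] at hyz ⊢
      rw [hxp] at hpb
      have := dist_triangle y z (x b.1)
      have : (1 : ℝ) ≤ 2 ^ (b.2 : ℕ) := one_le_pow₀ (by norm_num)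
      linarith
    · rw [← ENNReal.ofReal_sum_of_nonneg fun b _ => by positivity]
      refine ENNReal.ofReal_le_ofReal ?_
      refine le_trans (le_of_eq ?_) (mul_le_mul_of_nonneg_left hu (by positivity))
      rw [Finset.mul_sum]
      refine Finset.sum_congr rfl fun b _ => ?_
      rw [mul_div_assoc, Real.mul_rpow (by norm_num) (by positivity)]
  · rcases isEmpty_or_nonempty (Fin hF.toFinset.card) with h | ⟨⟨q⟩⟩
    · simp only [Finset.univ_eq_empty, Finset.sum_empty]
      positivity
    · have := hwc q (n + 1) (by omega)
      simp only [dist_eq_norm, hdist, if_true] at this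
      refine this.trans_eq ?_
      rw [pow_succ, mul_div_cancel_left₀ _ (by positivity)]
  · simp only [← Finset.mul_sum]
    rw [Finset.mul_sum, Finset.mul_sum]
    refine Finset.sum_le_sum fun i _ => ?_
    have := sum_kernel_le hw0 ht hts (fun j => hdist j i) (hwc i)
    calc _ = w i * (((2 : ℝ) ^ t) ^ n * ∑ j, w j * (1 / max (‖x i - x j‖ ^ t) 1)) := by ring
      _ ≤ w i * _ := mul_le_mul_of_nonneg_left this (hw0 i)
      _ = _ := mul_comm _ _

theorem energy_sum_smul_dirac {X ι : Type*} [NormedAddCommGroup X] [MeasurableSpace X]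
    [MeasurableSingletonClass X] [Fintype ι] (t : ℝ) (x : ι → X) (b : ι → ℝ)
    (hb : ∀ i, 0 ≤ b i) :
    energy t (∑ i, ENNReal.ofReal (b i) • Measure.dirac (x i)) =
      ENNReal.ofReal (∑ i, ∑ j, b i * (b j * (1 / max (‖x i - x j‖ ^ t) 1))) := by
  have hk : ∀ i j, 0 ≤ 1 / max (‖x i - x j‖ ^ t) 1 := fun i j => by positivity
  simp only [energy, lintegral_finsetSum_measure, lintegral_smul_measure, lintegral_dirac,
    smul_eq_mul]
  rw [ENNReal.ofReal_sum_of_nonneg fun i _ => Finset.sum_nonneg fun j _ =>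
    mul_nonneg (hb i) (mul_nonneg (hb j) (hk i j))]
  refine Finset.sum_congr rfl fun i _ => ?_
  rw [ENNReal.ofReal_sum_of_nonneg fun j _ => mul_nonneg (hb i) (mul_nonneg (hb j) (hk i j)),
    Finset.mul_sum]
  refine Finset.sum_congr rfl fun j _ => ?_
  rw [ENNReal.ofReal_mul (hb i), ENNReal.ofReal_mul (hb j)]

theorem sum_restrict_shell {X : Type*} [NormedAddCommGroup X] [MeasurableSpace X] [BorelSpace X]
    {ν : ℕ → Measure X} (hν : ∀ n, ∀ᵐ x ∂ν n, x ∈ shell X n) (n : ℕ) :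
    (Measure.sum ν).restrict (shell X n) = ν n := by
  rw [Measure.restrict_sum _ (measurableSet_shell n)]
  ext A hA
  rw [Measure.sum_apply _ hA, tsum_eq_single n fun m hm => ?_,
    Measure.restrict_eq_self_of_ae_mem (hν n)]
  have : (ν m).restrict (shell X n) = 0 := by
    rw [Measure.restrict_eq_zero, measure_eq_zero_iff_ae_notMem]
    filter_upwards [hν m] with x hx hx'
    exact hm (eq_of_mem_shell hx hx')
  simp [this]

theorem isLocallyFiniteMeasure_sum_shell {X : Type*} [NormedAddCommGroup X] [MeasurableSpace X]
    [BorelSpace X] {ν : ℕ → Measure X} [∀ n, IsFiniteMeasure (ν n)]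
    (hν : ∀ n, ∀ᵐ x ∂ν n, x ∈ shell X n) : IsLocallyFiniteMeasure (Measure.sum ν) := by
  refine ⟨fun x => ?_⟩
  obtain ⟨N, hN⟩ := pow_unbounded_of_one_lt ‖x‖ (one_lt_two (α := ℝ))
  refine ⟨ball 0 (2 ^ N), isOpen_ball.mem_nhds (by simpa using hN), ?_⟩
  rw [Measure.sum_apply _ measurableSet_ball,
    tsum_eq_sum (s := Finset.range (N + 1)) fun n hn => ?_]
  · exact ENNReal.sum_lt_top.2 fun n _ => measure_lt_top _ _
  · rw [measure_eq_zero_iff_ae_notMem]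
    filter_upwards [hν n] with y hy hyN
    have h1 : ‖y‖ < 2 ^ N := by simpa using hyN
    exact h1.not_ge (le_norm_of_mem_shell (by simpa using hn) hy)

/-- Potential-theoretic converse: if `ν̃^s(E) = ∞`, then for every `0 < ε < s` there is
a Radon measure `μ^ε` with `μ^ε(E) = ∞` and `Σₙ 2^{n(s-ε)} I_{s-ε}(μ^ε|_{Sₙ}) < ∞`. -/
theorem stmt14 (d : ℕ) (E : Set (EuclideanSpace ℝ (Fin d))) (s : ℝ)
    (h : ∑' n, nuT s n E = ⊤) (ε : ℝ) (hε0 : 0 < ε) (hεs : ε < s) :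
    ∃ μ : Measure (EuclideanSpace ℝ (Fin d)), IsLocallyFiniteMeasure μ ∧ μ E = ⊤ ∧
      ∑' n : ℕ, (2 : ℝ≥0∞) ^ ((n : ℝ) * (s - ε))
        * energy (s - ε) (μ.restrict (shell (EuclideanSpace ℝ (Fin d)) n)) < ⊤ := by
  set t := s - ε with ht_def
  have ht : 0 < t := by linarith
  have hts : t < s := by linarith
  choose m x w hx hw0 hnu hbound hen using exists_frostman_shell E ht.le hts
  set C : ℝ := 2 ^ t * (2 ^ (s - t)) ^ 2 / (2 ^ (s - t) - 1)
  have hnot : ¬ Summable fun n => ∑ i, w n i := fun hsum => by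
    have hsum' : Summable fun n => (7 : ℝ) ^ s * ∑ i, w n i := hsum.mul_left _
    exact hsum'.tsum_ofReal_ne_top (top_unique (h.symm.le.trans (ENNReal.tsum_le_tsum hnu)))
  have hm0 : ∀ n, 0 ≤ ∑ i, w n i := fun n => Finset.sum_nonneg fun i _ => hw0 n i
  obtain ⟨a, ha0, hdiv, hconv⟩ := exists_weights_not_summable_summable_sq hm0 hbound hnot
  have haw : ∀ n i, 0 ≤ a n * w n i := fun n i => mul_nonneg (ha0 n) (hw0 n i)
  set ν : ℕ → Measure (EuclideanSpace ℝ (Fin d)) := fun n =>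
    ∑ i, ENNReal.ofReal (a n * w n i) • Measure.dirac (x n i) with hν_def
  have hfin : ∀ n, IsFiniteMeasure (ν n) := fun n => ⟨by simp [hν_def]⟩
  have hν : ∀ n, ∀ A : Set (EuclideanSpace ℝ (Fin d)), (∀ i, x n i ∈ A) →
      ν n A = ENNReal.ofReal (a n * ∑ i, w n i) :=
    fun n A hA => by
      simp [hν_def, hA, Finset.mul_sum, ENNReal.ofReal_sum_of_nonneg fun i _ => haw n i]
  have hshell : ∀ n, ∀ᵐ y ∂ν n, y ∈ shell _ n := fun n => by
    have hc : ν n (shell _ n)ᶜ = 0 := by simp [hν_def, (hx n _).2]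
    exact hc
  refine ⟨Measure.sum ν, isLocallyFiniteMeasure_sum_shell hshell, ?_, ?_⟩
  · refine top_unique (le_trans ?_ (Measure.le_sum_apply ν E))
    simp only [fun n => hν n E fun i => (hx n i).1]
    refine top_le_iff.2 (by_contra fun hne => hdiv ?_)
    have := ENNReal.summable_toReal hne
    simpa only [ENNReal.toReal_ofReal (mul_nonneg (ha0 _) (hm0 _))] using this
  · refine lt_of_le_of_lt (ENNReal.tsum_le_tsum fun n => ?_)
      (hconv.mul_left C).tsum_ofReal_lt_top
    have hpow : (2 : ℝ≥0∞) ^ ((n : ℝ) * t) = ENNReal.ofReal (((2 : ℝ) ^ t) ^ n) := by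
      rw [← Real.rpow_natCast, ← Real.rpow_mul (by norm_num), mul_comm t,
        ← ENNReal.ofReal_rpow_of_pos (by norm_num)]
      simp
    rw [sum_restrict_shell hshell, hν_def, energy_sum_smul_dirac t (x n) _ (haw n), hpow,
      ← ENNReal.ofReal_mul (by positivity)]
    refine ENNReal.ofReal_le_ofReal ?_
    calc _ = a n ^ 2 * (((2 : ℝ) ^ t) ^ n *
          ∑ i, ∑ j, w n i * (w n j * (1 / max (‖x n i - x n j‖ ^ t) 1))) := by
          simp only [Finset.mul_sum]
          refine Finset.sum_congr rfl fun i _ => Finset.sum_congr rfl fun j _ => ?_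
          ring
      _ ≤ a n ^ 2 * (C * ∑ i, w n i) := mul_le_mul_of_nonneg_left (hen n) (sq_nonneg _)
      _ = _ := by ring
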